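/- Let d ≥ 1 and let F : ℝ^d → ℝ^d be a single-valued cyclically quasi-monotone map which is continuously differentiable (of class C¹) and satisfies F(x) ≠ 0 for every x ∈ ℝ^d. Then there exists a lower semi-continuous quasi-convex function f : ℝ^d → ℝ such that F(x) ∈ N_f(x) for every x ∈ ℝ^d. -/

import Mathlib

open scoped RealInnerProductSpace

/-- Cyclic quasi-monotonicity of a single-valued map `F : ℝ^d → ℝ^d`. -/
def CyclicallyQuasiMonotoneS {d : ℕ}
    (F : EuclideanSpace ℝ (Fin d) → EuclideanSpace ℝ (Fin d)) : Prop :=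
  ∀ (N : ℕ) (x : ℕ → EuclideanSpace ℝ (Fin d)),
    0 < N → x N = x 0 →
    ∃ i < N, ⟪F (x i), x (i + 1) - x i⟫ ≤ 0

/-- The normal cone multi-map of a real-valued function `f`. -/
def NormalConeMap {d : ℕ} (f : EuclideanSpace ℝ (Fin d) → ℝ) (x : EuclideanSpace ℝ (Fin d)) :
    Set (EuclideanSpace ℝ (Fin d)) :=
  {p | ∀ w, f w ≤ f x → ⟪p, w - x⟫ ≤ 0}

open Relation

theorem Relation.TransGen.exists_chain {α : Type*} {r : α → α → Prop} {a b : α}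
    (h : TransGen r a b) :
    ∃ (N : ℕ) (u : ℕ → α), 0 < N ∧ u 0 = a ∧ u N = b ∧ ∀ i < N, r (u i) (u (i + 1)) := by
  induction h with
  | @single b hab =>
    refine ⟨1, fun n => if n = 0 then a else b, one_pos, by simp, by simp, fun i hi => ?_⟩
    obtain rfl : i = 0 := by lia
    simpa using hab
  | @tail b c _ hbc ih =>
    obtain ⟨N, u, _, h0, hN, hu⟩ := ih
    refine ⟨N + 1, fun n => if n ≤ N then u n else c, by lia, by simp [h0], by simp,
      fun i hi => ?_⟩
    rcases Nat.lt_succ_iff_lt_or_eq.mp hi with hi | rfl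
    · simpa [hi.le, Nat.succ_le_iff.mpr hi] using hu i hi
    · simpa [hN] using hbc

section Precedence

variable {d : ℕ} {F : EuclideanSpace ℝ (Fin d) → EuclideanSpace ℝ (Fin d)}

/-- `y` lies strictly on the positive side of the hyperplane through `x` normal to `F x`. -/
def Ahead (F : EuclideanSpace ℝ (Fin d) → EuclideanSpace ℝ (Fin d))
    (x y : EuclideanSpace ℝ (Fin d)) : Prop :=
  0 < ⟪F x, y - x⟫

theorem CyclicallyQuasiMonotoneS.not_transGen_self (hF : CyclicallyQuasiMonotoneS F)
    (x : EuclideanSpace ℝ (Fin d)) : ¬ TransGen (Ahead F) x x := by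
  intro h
  obtain ⟨N, u, hN, h0, hN', hu⟩ := h.exists_chain
  obtain ⟨i, hi, hle⟩ := hF N u hN (hN'.trans h0.symm)
  exact (hu i hi).not_ge hle

theorem setOf_transGen_ahead (q : EuclideanSpace ℝ (Fin d)) :
    {y | TransGen (Ahead F) q y} =
      ⋃ z ∈ {z | ReflTransGen (Ahead F) q z}, {y | Ahead F z y} := by
  ext y
  simp [TransGen.tail'_iff]

theorem isOpen_setOf_transGen_ahead (q : EuclideanSpace ℝ (Fin d)) :
    IsOpen {y | TransGen (Ahead F) q y} := by
  rw [setOf_transGen_ahead]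
  exact isOpen_biUnion fun z _ => isOpen_lt continuous_const (by fun_prop)

theorem convex_setOf_not_transGen_ahead (q : EuclideanSpace ℝ (Fin d)) :
    Convex ℝ {y | ¬ TransGen (Ahead F) q y} := by
  have h : {y | ¬ TransGen (Ahead F) q y} =
      ⋂ z ∈ {z | ReflTransGen (Ahead F) q z}, {y | ⟪F z, y⟫ ≤ ⟪F z, z⟫} := by
    rw [← Set.compl_ofPred, setOf_transGen_ahead]
    ext y
    simp [Ahead, inner_sub_right]
  rw [h]
  exact convex_iInter₂ fun z _ => convex_halfSpace_le (innerSL ℝ (F z)).isLinear _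

theorem Ahead.exists_mem_between (hc : Continuous F) (hnv : ∀ x, F x ≠ 0)
    {s : Set (EuclideanSpace ℝ (Fin d))} (hs : Dense s) {x y : EuclideanSpace ℝ (Fin d)}
    (h : Ahead F x y) : ∃ q ∈ s, Ahead F x q ∧ Ahead F q y := by
  have hxo : IsOpen {q | Ahead F x q} := isOpen_lt continuous_const (by fun_prop)
  have hyo : IsOpen {q | Ahead F q y} := isOpen_lt continuous_const (by fun_prop)
  have hmem : ∀ᶠ t in nhdsWithin (0 : ℝ) (Set.Ioi 0), Ahead F (x + t • F x) y := by
    have hcont : Continuous fun t : ℝ => x + t • F x := by fun_prop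
    exact nhdsWithin_le_nhds
      (hcont.continuousAt.preimage_mem_nhds (hyo.mem_nhds (by simpa using h)))
  obtain ⟨t, hty, ht⟩ := (hmem.and self_mem_nhdsWithin).exists
  have htx : Ahead F x (x + t • F x) := by
    have := real_inner_self_pos.mpr (hnv x)
    simpa [Ahead, inner_smul_right] using mul_pos ht this
  obtain ⟨q, hq, hqs⟩ := hs.inter_open_nonempty _ (hxo.inter hyo) ⟨_, htx, hty⟩
  exact ⟨q, hqs, hq⟩

open Classical in
/-- A utility function built from a dense sequence: a weighted count of its terms preceding `x`. -/
noncomputable def precedenceWeight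
    (F : EuclideanSpace ℝ (Fin d) → EuclideanSpace ℝ (Fin d))
    (x : EuclideanSpace ℝ (Fin d)) : ℝ :=
  ∑' n, if TransGen (Ahead F) (TopologicalSpace.denseSeq _ n) x then (1 / 2 : ℝ) ^ n else 0

open Classical in
theorem summable_precedenceWeight (x : EuclideanSpace ℝ (Fin d)) :
    Summable fun n => if TransGen (Ahead F) (TopologicalSpace.denseSeq _ n) x
      then (1 / 2 : ℝ) ^ n else 0 :=
  summable_geometric_two.of_nonneg_of_le (fun n => by split_ifs <;> positivity)
    (fun n => by split_ifs <;> first | exact le_rfl | positivity)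

theorem precedenceWeight_nonneg (x : EuclideanSpace ℝ (Fin d)) : 0 ≤ precedenceWeight F x :=
  tsum_nonneg fun n => by split_ifs <;> positivity

theorem precedenceWeight_le_two (x : EuclideanSpace ℝ (Fin d)) : precedenceWeight F x ≤ 2 := by
  rw [← tsum_geometric_two]
  exact (summable_precedenceWeight x).tsum_le_tsum
    (fun n => by split_ifs <;> first | exact le_rfl | positivity) summable_geometric_two

theorem precedenceWeight_mono {x y : EuclideanSpace ℝ (Fin d)} (h : TransGen (Ahead F) x y) :
    precedenceWeight F x ≤ precedenceWeight F y := by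
  refine (summable_precedenceWeight x).tsum_le_tsum (fun n => ?_) (summable_precedenceWeight y)
  split_ifs with hx hy hy
  · exact le_rfl
  · exact absurd (hx.trans h) hy
  · positivity
  · exact le_rfl

theorem precedenceWeight_lt (hc : Continuous F) (hnv : ∀ x, F x ≠ 0)
    (hF : CyclicallyQuasiMonotoneS F) {x y : EuclideanSpace ℝ (Fin d)} (h : Ahead F x y) :
    precedenceWeight F x < precedenceWeight F y := by
  obtain ⟨_, ⟨n, rfl⟩, hxq, hqy⟩ :=
    h.exists_mem_between hc hnv (TopologicalSpace.denseRange_denseSeq _)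
  refine (summable_precedenceWeight x).tsum_lt_tsum (i := n) (fun m => ?_) ?_
    (summable_precedenceWeight y)
  · split_ifs with hx hy hy
    · exact le_rfl
    · exact absurd (hx.tail h) hy
    · positivity
    · exact le_rfl
  · rw [if_neg fun hq => hF.not_transGen_self x (TransGen.head hxq hq),
      if_pos (TransGen.single hqy)]
    positivity

/-- The quasi-convex potential: the supremum of the weights of the points preceding `x`. -/
noncomputable def quasiPotential (F : EuclideanSpace ℝ (Fin d) → EuclideanSpace ℝ (Fin d))
    (x : EuclideanSpace ℝ (Fin d)) : ℝ :=
  ⨆ q, Set.indicator {y | TransGen (Ahead F) q y} (fun _ => precedenceWeight F q) x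

theorem bddAbove_quasiPotential (x : EuclideanSpace ℝ (Fin d)) :
    BddAbove (Set.range fun q =>
      Set.indicator {y | TransGen (Ahead F) q y} (fun _ => precedenceWeight F q) x) := by
  refine ⟨2, ?_⟩
  rintro _ ⟨q, rfl⟩
  exact Set.indicator_apply_le' (fun _ => precedenceWeight_le_two q) fun _ => zero_le_two

theorem lowerSemicontinuous_quasiPotential : LowerSemicontinuous (quasiPotential F) :=
  lowerSemicontinuous_ciSup bddAbove_quasiPotential fun q =>
    (isOpen_setOf_transGen_ahead q).lowerSemicontinuous_indicator (precedenceWeight_nonneg q)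

theorem convex_quasiPotential_le (ℓ : ℝ) : Convex ℝ {x | quasiPotential F x ≤ ℓ} := by
  have h : {x | quasiPotential F x ≤ ℓ} = ⋂ q, {x |
      Set.indicator {y | TransGen (Ahead F) q y} (fun _ => precedenceWeight F q) x ≤ ℓ} := by
    ext x
    simp only [Set.mem_ofPred_eq, Set.mem_iInter]
    exact ciSup_le_iff (bddAbove_quasiPotential x)
  rw [h]
  refine convex_iInter fun q => ?_
  by_cases hq : precedenceWeight F q ≤ ℓ
  · by_cases h0 : 0 ≤ ℓ
    · convert convex_univ
      refine Set.eq_univ_of_forall fun x => ?_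
      rw [Set.mem_ofPred_eq]
      exact Set.indicator_apply_le' (fun _ => hq) fun _ => h0
    · exact absurd ((precedenceWeight_nonneg q).trans hq) h0
  · by_cases h0 : 0 ≤ ℓ
    · convert convex_setOf_not_transGen_ahead (F := F) q using 1
      ext x
      by_cases hx : TransGen (Ahead F) q x <;> simp [Set.indicator, hx, hq, h0]
    · convert convex_empty
      ext x
      by_cases hx : TransGen (Ahead F) q x <;> simp [Set.indicator, hx] <;> linarith

theorem quasiPotential_lt (hc : Continuous F) (hnv : ∀ x, F x ≠ 0)
    (hF : CyclicallyQuasiMonotoneS F) {x y : EuclideanSpace ℝ (Fin d)} (h : Ahead F x y) :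
    quasiPotential F x < quasiPotential F y := by
  obtain ⟨q, -, hxq, hqy⟩ := h.exists_mem_between hc hnv dense_univ
  calc quasiPotential F x ≤ precedenceWeight F x :=
        ciSup_le fun z => Set.indicator_apply_le' (fun hz => precedenceWeight_mono hz)
          fun _ => precedenceWeight_nonneg x
    _ < precedenceWeight F q := precedenceWeight_lt hc hnv hF hxq
    _ = Set.indicator {y | TransGen (Ahead F) q y} (fun _ => precedenceWeight F q) y :=
        (Set.indicator_of_mem (s := {y | TransGen (Ahead F) q y}) (TransGen.single hqy)
          (fun _ => precedenceWeight F q)).symm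
    _ ≤ quasiPotential F y := le_ciSup (bddAbove_quasiPotential y) q

end Precedence

theorem stmt19 (d : ℕ) (hd : 1 ≤ d)
    (F : EuclideanSpace ℝ (Fin d) → EuclideanSpace ℝ (Fin d))
    (hreg : ContDiff ℝ 1 F) (hF : CyclicallyQuasiMonotoneS F)
    (hnv : ∀ x, F x ≠ 0) :
    ∃ f : EuclideanSpace ℝ (Fin d) → ℝ, LowerSemicontinuous f ∧
      (∀ ℓ : ℝ, Convex ℝ {x | f x ≤ ℓ}) ∧
      ∀ x, F x ∈ NormalConeMap f x := by
  refine ⟨quasiPotential F, lowerSemicontinuous_quasiPotential, convex_quasiPotential_le,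
    fun x w hw => ?_⟩
  by_contra! h
  exact (quasiPotential_lt hreg.continuous hnv hF h).not_ge hw
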